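/- Let V be a finite-dimensional representation of Γ₁ = SL₂(ℤ) over a field F of characteristic different from 2 and 3, on which −1 acts trivially. Let G₂ and G₃ be the subgroups of PSL₂(ℤ) generated by the images of S = [[0,−1],[1,0]] and U = [[1,−1],[1,0]] respectively (cyclic of orders 2 and 3). Then dim H¹(Γ₁, V) = dim V − dim H⁰(G₂, V) − dim H⁰(G₃, V) + dim H⁰(Γ₁, V). -/

import Mathlib

noncomputable section

namespace GC

variable {F : Type*} [Field F] {V : Type*} [AddCommGroup V] [Module F V]
variable {G : Type*} [Group G]

/-- Cocycles for a (right) action `ρ` of `G` on `V` by linear maps: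
`φ(gh) = φ(g)|h + φ(h)`. -/
def Z1 (ρ : G → V →ₗ[F] V) : Submodule F (G → V) where
  carrier := {φ | ∀ g h, φ (g * h) = ρ h (φ g) + φ h}
  add_mem' := by
    intro f g hf hg a b
    simp only [Pi.add_apply, hf a b, hg a b, _root_.map_add]
    abel
  zero_mem' := by intro a b; simp
  smul_mem' := by
    intro c f hf a b
    simp only [Pi.smul_apply, hf a b, _root_.map_smul, smul_add]

/-- Coboundaries: `φ(g) = v|g - v` for some `v ∈ V`. -/
def B1 (ρ : G → V →ₗ[F] V) : Submodule F (G → V) where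
  carrier := {φ | ∃ v, ∀ g, φ g = ρ g v - v}
  add_mem' := by
    rintro f g ⟨v, hv⟩ ⟨u, hu⟩
    exact ⟨v + u, fun x => by simp only [Pi.add_apply, hv x, hu x, _root_.map_add]; abel⟩
  zero_mem' := ⟨0, by simp⟩
  smul_mem' := by
    rintro c f ⟨v, hv⟩
    exact ⟨c • v, fun x => by simp only [Pi.smul_apply, hv x, _root_.map_smul, smul_sub]⟩

/-- First group cohomology `H¹(G, V) = Z¹/B¹` for the action `ρ`. -/
def H1 (ρ : G → V →ₗ[F] V) :=
  ↥(Z1 ρ) ⧸ ((B1 ρ ⊓ Z1 ρ).comap (Z1 ρ).subtype)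

instance (ρ : G → V →ₗ[F] V) : AddCommGroup (H1 ρ) := by
  unfold H1; infer_instance

instance (ρ : G → V →ₗ[F] V) : Module F (H1 ρ) := by
  unfold H1; infer_instance

/-- Restriction of cocycles along a group homomorphism. -/
def resZ (ρ : G → V →ₗ[F] V) {H : Type*} [Group H] (ι : H →* G) :
    ↥(Z1 ρ) →ₗ[F] ↥(Z1 (fun h => ρ (ι h))) :=
  LinearMap.codRestrict _ ((LinearMap.funLeft F V ι).comp (Z1 ρ).subtype)
    (by
      rintro ⟨φ, hφ⟩ g h
      simpa [LinearMap.funLeft, _root_.map_mul] using hφ (ι g) (ι h))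

/-- Restriction map in first group cohomology along a group homomorphism. -/
def resH1 (ρ : G → V →ₗ[F] V) {H : Type*} [Group H] (ι : H →* G) :
    H1 ρ →ₗ[F] H1 (fun h => ρ (ι h)) :=
  Submodule.mapQ _ _ (resZ ρ ι)
    (by
      rintro ⟨φ, hφ⟩ hmem
      rcases hmem.1 with ⟨v, hv⟩
      refine ⟨⟨v, fun h => ?_⟩, (resZ ρ ι ⟨φ, hφ⟩).2⟩
      have := hv (ι h)
      simpa [resZ, LinearMap.funLeft] using this)

/-- The invariants `H⁰(s, V) = {v | v|g = v for all g ∈ s}`. -/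
def invariants (ρ : G → V →ₗ[F] V) (s : Set G) : Submodule F V where
  carrier := {v | ∀ g ∈ s, ρ g v = v}
  add_mem' := by intro u v hu hv g hg; simp [_root_.map_add, hu g hg, hv g hg]
  zero_mem' := by intro g hg; simp
  smul_mem' := by intro c v hv g hg; simp [_root_.map_smul, hv g hg]

/-- The coefficient matrix of the weight `-w` slash action of the matrix
`[[a,b],[c,d]]` on polynomials of degree at most `w`, in the basis `1, X, …, X^w`:
`X^i ↦ (aX+b)^i (cX+d)^(w-i)`. -/
def slashCoeff (F : Type*) [Field F] (w : ℕ) (a b c d : F) :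
    Matrix (Fin (w+1)) (Fin (w+1)) F :=
  fun j i =>
    (((Polynomial.C a * Polynomial.X + Polynomial.C b) ^ (i : ℕ)) *
      ((Polynomial.C c * Polynomial.X + Polynomial.C d) ^ (w - (i : ℕ)))).coeff (j : ℕ)

/-- The weight `-w` slash action as a linear endomorphism of `V_w(F) ≅ F^{w+1}`
(coordinates with respect to the basis `1, X, …, X^w`). -/
def slashLin (F : Type*) [Field F] (w : ℕ) (a b c d : F) :
    (Fin (w+1) → F) →ₗ[F] (Fin (w+1) → F) :=
  Matrix.toLin' (slashCoeff F w a b c d)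

end GC

open GC Matrix MatrixGroups

/-- `S = [[0,-1],[1,0]] ∈ SL₂(ℤ)`. -/
def Smat : SL(2,ℤ) := ⟨!![0,-1;1,0], by norm_num [Matrix.det_fin_two_of]⟩
/-- `U = [[1,-1],[1,0]] ∈ SL₂(ℤ)`. -/
def Umat : SL(2,ℤ) := ⟨!![1,-1;1,0], by norm_num [Matrix.det_fin_two_of]⟩
/-- `-1 ∈ SL₂(ℤ)`. -/
def negOne : SL(2,ℤ) := ⟨!![-1,0;0,-1], by norm_num [Matrix.det_fin_two_of]⟩

namespace DimH1

lemma closure_SU : Subgroup.closure {Smat, Umat} = (⊤ : Subgroup SL(2,ℤ)) := by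
  rw [eq_top_iff, ← SpecialLinearGroup.SL2Z_generators, Subgroup.closure_le]
  have hS : Smat ∈ Subgroup.closure {Smat, Umat} := Subgroup.subset_closure (by simp)
  have hU : Umat ∈ Subgroup.closure {Smat, Umat} := Subgroup.subset_closure (by simp)
  have e1 : ModularGroup.S = Smat := by
    ext i j; fin_cases i <;> fin_cases j <;> simp [ModularGroup.S, Smat]
  have e2 : ModularGroup.T * Smat = Umat := by
    apply Subtype.ext; decide
  rintro x (rfl | rfl)
  · rw [e1]; exact hS
  · rw [eq_mul_inv_of_mul_eq e2]
    exact mul_mem hU (inv_mem hS)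

lemma S_sq : Smat * Smat = negOne := by
  apply Subtype.ext; decide

lemma U_cube : Umat * Umat * Umat = negOne := by
  apply Subtype.ext; decide

lemma neg_sq : negOne * negOne = 1 := by
  apply Subtype.ext; decide

/-- The homomorphism out of a cyclic group of order `n` determined by an element with `s ^ n = 1`. -/
def cyc {E : Type*} [Group E] (n : ℕ) (s : E) (h : s ^ n = 1) : Multiplicative (ZMod n) →* E :=
  AddMonoidHom.toMultiplicativeLeft
    (ZMod.lift n ⟨zmultiplesHom (Additive E) (Additive.ofMul s), by
      simp only [zmultiplesHom_apply, natCast_zsmul]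
      rw [← ofMul_pow, h]; rfl⟩)

lemma cyc_int {E : Type*} [Group E] (n : ℕ) (s : E) (h : s ^ n = 1) (k : ℤ) :
    cyc n s h (Multiplicative.ofAdd (k : ZMod n)) = s ^ k := by
  change Additive.toMul (ZMod.lift n _ (k : ZMod n)) = s ^ k
  rw [ZMod.lift_coe]
  simp

lemma cyc_one {E : Type*} [Group E] (n : ℕ) (s : E) (h : s ^ n = 1) :
    cyc n s h (Multiplicative.ofAdd 1) = s := by
  simpa using cyc_int n s h 1

/-- Congruence action on matrices, on which `-1` acts trivially. -/
def congHom : SL(2,ℤ) →* (Function.End (Matrix (Fin 2) (Fin 2) ℤ))ˣ :=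
  MonoidHom.toHomUnits
    { toFun := fun g M => (g : Matrix (Fin 2) (Fin 2) ℤ) * M * (g : Matrix (Fin 2) (Fin 2) ℤ)ᵀ
      map_one' := by funext M; simp; rfl
      map_mul' := by
        intro g h; funext M
        simp [Matrix.mul_assoc, Matrix.transpose_mul]
        change _ = (g : Matrix (Fin 2) (Fin 2) ℤ) * ((h : Matrix (Fin 2) (Fin 2) ℤ) *
          (M * (h : Matrix (Fin 2) (Fin 2) ℤ)ᵀ) * (g : Matrix (Fin 2) (Fin 2) ℤ)ᵀ)
        simp only [Matrix.mul_assoc] }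

lemma congHom_smul (g : SL(2,ℤ)) (M : Matrix (Fin 2) (Fin 2) ℤ) :
    congHom g • M = (g : Matrix (Fin 2) (Fin 2) ℤ) * M * (g : Matrix (Fin 2) (Fin 2) ℤ)ᵀ := rfl

lemma congHom_neg : congHom negOne = 1 := by
  ext1; funext M
  change (negOne : Matrix (Fin 2) (Fin 2) ℤ) * M * (negOne : Matrix (Fin 2) (Fin 2) ℤ)ᵀ = M
  ext i j
  fin_cases i <;> fin_cases j <;>
    simp [negOne, Matrix.mul_apply, Fin.sum_univ_two, Matrix.vecMul, dotProduct]

lemma smulS (M : Matrix (Fin 2) (Fin 2) ℤ) :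
    congHom Smat • M = !![M 1 1, -M 1 0; -M 0 1, M 0 0] := by
  rw [congHom_smul]
  have : (Smat : Matrix (Fin 2) (Fin 2) ℤ) = !![0,-1;1,0] := rfl
  rw [this]
  ext i j
  fin_cases i <;> fin_cases j <;>
    simp [Matrix.mul_apply, Fin.sum_univ_two, Matrix.vecMul, dotProduct]

lemma smulU (M : Matrix (Fin 2) (Fin 2) ℤ) :
    congHom Umat • M = !![M 0 0 - M 0 1 - M 1 0 + M 1 1, M 0 0 - M 1 0; M 0 0 - M 0 1, M 0 0] := by
  rw [congHom_smul]
  have : (Umat : Matrix (Fin 2) (Fin 2) ℤ) = !![1,-1;1,0] := rfl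
  rw [this]
  ext i j
  fin_cases i <;> fin_cases j <;>
    simp [Matrix.mul_apply, Fin.sum_univ_two, Matrix.vecMul, dotProduct] <;> ring

/-- the orders -/
def ord : Bool → ℕ
  | false => 2
  | true => 3

/-- the generators -/
def gen {E : Type*} (s u : E) : Bool → E
  | false => s
  | true => u

lemma gen_pow {E : Type*} [Group E] {s u : E} (hs : s ^ 2 = 1) (hu : u ^ 3 = 1) (i : Bool) :
    gen s u i ^ ord i = 1 := by
  cases i
  · exact hs
  · exact hu

/-- The ping-pong sets. -/
def pp : Bool → Set (Matrix (Fin 2) (Fin 2) ℤ)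
  | false => {M | 0 < M 0 0 ∧ 0 < M 1 1 ∧ M 0 1 < 0 ∧ M 1 0 < 0}
  | true => {M | 0 < M 0 0 ∧ 0 < M 1 1 ∧ 0 < M 0 1 ∧ 0 < M 1 0}

lemma cS : congHom Smat ^ 2 = 1 := by rw [← map_pow, pow_two, S_sq, congHom_neg]
lemma cU : congHom Umat ^ 3 = 1 := by rw [← map_pow, pow_succ, pow_two, U_cube, congHom_neg]

/-- The free product of cyclic groups of order two and three. -/
abbrev K := Monoid.CoprodI (fun i : Bool => Multiplicative (ZMod (ord i)))

/-- The family of homs. -/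
abbrev fam {E : Type*} [Group E] {s u : E} (hs : s ^ 2 = 1) (hu : u ^ 3 = 1) (i : Bool) :
    Multiplicative (ZMod (ord i)) →* E := cyc (ord i) (gen s u i) (gen_pow hs hu i)

open scoped Pointwise in
lemma inj : Function.Injective (Monoid.CoprodI.lift (fam cS cU)) := by
  apply Monoid.CoprodI.lift_injective_of_ping_pong (X := pp)
  · rintro (_ | _)
    · exact ⟨!![1,-1;-1,1], by simp [pp]⟩
    · exact ⟨!![1,1;1,1], by simp [pp]⟩
  · rintro (_ | _) (_ | _) h
    · exact absurd rfl h
    · change Disjoint _ _; rw [Set.disjoint_left]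
      rintro M ⟨_, _, h, _⟩ ⟨_, _, h', _⟩; omega
    · change Disjoint _ _; rw [Set.disjoint_left]
      rintro M ⟨_, _, h, _⟩ ⟨_, _, h', _⟩; omega
    · exact absurd rfl h
  · rintro (_ | _) (_ | _) h x hx
    · exact absurd rfl h
    · have hx' : x = Multiplicative.ofAdd (1 : ZMod 2) := by
        revert hx; change x ≠ Multiplicative.ofAdd (0 : ZMod 2) → _
        revert x; change ∀ x : ZMod 2, x ≠ 0 → x = 1; decide
      have e : fam cS cU false x = congHom Smat := by
        rw [hx']; exact cyc_one 2 _ _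
      rw [e]
      rintro _ ⟨M, ⟨h1, h2, h3, h4⟩, rfl⟩
      change congHom Smat • M ∈ _
      rw [smulS]
      simp [pp]
      omega
    · have hx' : x = Multiplicative.ofAdd (1 : ZMod 3) ∨
          x = Multiplicative.ofAdd (((2 : ℤ) : ZMod 3)) := by
        revert hx; change x ≠ Multiplicative.ofAdd (0 : ZMod 3) → _
        revert x; change ∀ x : ZMod 3, x ≠ 0 → x = 1 ∨ x = ((2 : ℤ) : ZMod 3); decide
      have key : ∀ M ∈ pp false, congHom Umat • M ∈ pp true ∧
          congHom Umat • congHom Umat • M ∈ pp true := by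
        rintro M ⟨h1, h2, h3, h4⟩
        rw [smulU, smulU]
        simp [pp]
        omega
      rcases hx' with hx' | hx'
      · have e : fam cS cU true x = congHom Umat := by
          rw [hx']; exact cyc_one 3 _ _
        rw [e]
        rintro _ ⟨M, hM, rfl⟩
        exact (key M hM).1
      · have e : fam cS cU true x = congHom Umat * congHom Umat := by
          rw [hx']; refine (cyc_int 3 _ _ 2).trans ?_
          rw [zpow_two]; rfl
        rw [e]
        rintro _ ⟨M, hM, rfl⟩
        change (congHom Umat * congHom Umat) • M ∈ _
        rw [mul_smul]
        exact (key M hM).2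
    · exact absurd rfl h
  · right
    refine ⟨true, ?_⟩
    change (3 : Cardinal) ≤ Cardinal.mk (ZMod 3)
    rw [Cardinal.mk_fintype, ZMod.card]; norm_num

lemma lift_gen {E : Type*} [Group E] {s u : E} (hs : s ^ 2 = 1) (hu : u ^ 3 = 1) (i : Bool) :
    Monoid.CoprodI.lift (fam hs hu) (Monoid.CoprodI.of (i := i) (Multiplicative.ofAdd 1))
      = gen s u i := by
  rw [Monoid.CoprodI.lift_of]; exact cyc_one _ _ _

lemma congHom_mem (g : SL(2,ℤ)) : congHom g ∈ (Monoid.CoprodI.lift (fam cS cU)).range := by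
  have : (⊤ : Subgroup SL(2,ℤ)) ≤ (Monoid.CoprodI.lift (fam cS cU)).range.comap congHom := by
    rw [← closure_SU, Subgroup.closure_le]
    rintro x (rfl | rfl)
    · exact ⟨_, lift_gen cS cU false⟩
    · exact ⟨_, lift_gen cS cU true⟩
  exact this (Subgroup.mem_top g)

/-- Universal property of `PSL₂(ℤ)` as a free product. -/
theorem exists_hom {E : Type*} [Group E] {s u : E} (hs : s ^ 2 = 1) (hu : u ^ 3 = 1) :
    ∃ Φ : SL(2,ℤ) →* E, Φ Smat = s ∧ Φ Umat = u := by
  let e := MonoidHom.ofInjective inj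
  let c : SL(2,ℤ) →* (Monoid.CoprodI.lift (fam cS cU)).range := congHom.codRestrict _ congHom_mem
  refine ⟨(Monoid.CoprodI.lift (fam hs hu)).comp (e.symm.toMonoidHom.comp c), ?_, ?_⟩
  · have : e.symm (c Smat) = Monoid.CoprodI.of (i := false) (Multiplicative.ofAdd 1) := by
      rw [MulEquiv.symm_apply_eq]
      exact Subtype.ext (lift_gen cS cU false).symm
    change Monoid.CoprodI.lift (fam hs hu) (e.symm (c Smat)) = s
    rw [this]; exact lift_gen hs hu false
  · have : e.symm (c Umat) = Monoid.CoprodI.of (i := true) (Multiplicative.ofAdd 1) := by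
      rw [MulEquiv.symm_apply_eq]
      exact Subtype.ext (lift_gen cS cU true).symm
    change Monoid.CoprodI.lift (fam hs hu) (e.symm (c Umat)) = u
    rw [this]; exact lift_gen hs hu true

theorem exists_hom_monoid {E : Type*} [Monoid E] {s u : E} (hs : s ^ 2 = 1) (hu : u ^ 3 = 1) :
    ∃ Φ : SL(2,ℤ) →* E, Φ Smat = s ∧ Φ Umat = u := by
  obtain ⟨Φ, h1, h2⟩ := exists_hom (E := Eˣ) (s := Units.ofPowEqOne s 2 hs (by norm_num))
    (u := Units.ofPowEqOne u 3 hu (by norm_num)) (by ext; simp) (by ext; simp)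
  exact ⟨(Units.coeHom E).comp Φ, by simp [h1], by simp [h2]⟩

section main

variable {F : Type*} [Field F] {V : Type*} [AddCommGroup V] [Module F V]
variable {ρ : SL(2,ℤ) → V →ₗ[F] V}

lemma inv_closure (hmul : ∀ g h : SL(2,ℤ), ρ (g * h) = (ρ h).comp (ρ g))
    (hone : ρ 1 = LinearMap.id) (s : Set SL(2,ℤ)) (v : V) (hv : ∀ g ∈ s, ρ g v = v) :
    v ∈ invariants ρ (Subgroup.closure s : Subgroup SL(2,ℤ)) := by
  intro g hg
  induction hg using Subgroup.closure_induction with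
  | mem x hx => exact hv x hx
  | one => simp [hone]
  | mul x y _ _ hx hy => simp [hmul, hx, hy]
  | inv x _ hx =>
    have := congrArg (fun f => f v) (hmul x x⁻¹)
    simp only [mul_inv_cancel, hone, LinearMap.comp_apply, hx, LinearMap.id_apply] at this
    exact this.symm

lemma rhoS (hmul : ∀ g h : SL(2,ℤ), ρ (g * h) = (ρ h).comp (ρ g))
    (hneg : ρ negOne = LinearMap.id) (v : V) : ρ Smat (ρ Smat v) = v := by
  have := congrArg (fun f => f v) (hmul Smat Smat)
  simpa [S_sq, hneg] using this.symm

lemma rhoU (hmul : ∀ g h : SL(2,ℤ), ρ (g * h) = (ρ h).comp (ρ g))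
    (hneg : ρ negOne = LinearMap.id) (v : V) : ρ Umat (ρ Umat (ρ Umat v)) = v := by
  have := congrArg (fun f => f v) (hmul (Umat * Umat) Umat)
  rw [U_cube, hneg, hmul] at this
  simpa using this.symm

/-- norm map for `S` -/
def NS (ρ : SL(2,ℤ) → V →ₗ[F] V) : V →ₗ[F] V := ρ Smat + LinearMap.id
/-- norm map for `U` -/
def NU (ρ : SL(2,ℤ) → V →ₗ[F] V) : V →ₗ[F] V :=
  (ρ Umat).comp (ρ Umat) + ρ Umat + LinearMap.id

lemma range_NS (h2 : (2 : F) ≠ 0) (hmul : ∀ g h : SL(2,ℤ), ρ (g * h) = (ρ h).comp (ρ g))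
    (hone : ρ 1 = LinearMap.id) (hneg : ρ negOne = LinearMap.id) :
    LinearMap.range (NS ρ) = invariants ρ (Subgroup.closure {Smat} : Subgroup SL(2,ℤ)) := by
  apply le_antisymm
  · rintro _ ⟨v, rfl⟩
    apply inv_closure hmul hone
    rintro _ rfl
    simp [NS, rhoS hmul hneg, add_comm]
  · intro v hv
    have hv' : ρ Smat v = v := hv Smat (Subgroup.subset_closure rfl)
    refine ⟨(2 : F)⁻¹ • v, ?_⟩
    simp only [NS, map_smul, LinearMap.add_apply, LinearMap.id_apply, hv']
    rw [← two_smul F v, smul_smul, inv_mul_cancel₀ h2, one_smul]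

lemma range_NU (h3 : (3 : F) ≠ 0) (hmul : ∀ g h : SL(2,ℤ), ρ (g * h) = (ρ h).comp (ρ g))
    (hone : ρ 1 = LinearMap.id) (hneg : ρ negOne = LinearMap.id) :
    LinearMap.range (NU ρ) = invariants ρ (Subgroup.closure {Umat} : Subgroup SL(2,ℤ)) := by
  apply le_antisymm
  · rintro _ ⟨v, rfl⟩
    apply inv_closure hmul hone
    rintro _ rfl
    simp only [NU, LinearMap.add_apply, LinearMap.comp_apply, LinearMap.id_apply, map_add,
      rhoU hmul hneg]
    abel
  · intro v hv
    have hv' : ρ Umat v = v := hv Umat (Subgroup.subset_closure rfl)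
    refine ⟨(3 : F)⁻¹ • v, ?_⟩
    simp only [NU, map_smul, LinearMap.add_apply, LinearMap.comp_apply, LinearMap.id_apply, hv']
    have : v + v + v = (3 : F) • v := by
      rw [show (3 : F) = 1 + 1 + 1 by norm_num]; simp [add_smul]
    rw [this, smul_smul, inv_mul_cancel₀ h3, one_smul]

/-- evaluation at the generators -/
def ev (ρ : SL(2,ℤ) → V →ₗ[F] V) : ↥(Z1 ρ) →ₗ[F] V × V where
  toFun φ := (φ.1 Smat, φ.1 Umat)
  map_add' _ _ := rfl
  map_smul' _ _ := rfl

lemma Z1_one (hone : ρ 1 = LinearMap.id) {φ : SL(2,ℤ) → V} (hφ : φ ∈ Z1 ρ) : φ 1 = 0 := by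
  have := hφ 1 1
  simpa [hone] using this

lemma Z1_neg (h2 : (2 : F) ≠ 0) (hone : ρ 1 = LinearMap.id) (hneg : ρ negOne = LinearMap.id)
    {φ : SL(2,ℤ) → V} (hφ : φ ∈ Z1 ρ) : φ negOne = 0 := by
  have := hφ negOne negOne
  rw [neg_sq, Z1_one hone hφ, hneg, LinearMap.id_apply, ← two_smul F] at this
  exact (smul_eq_zero.mp this.symm).resolve_left h2

lemma ev_injective (hone : ρ 1 = LinearMap.id) : Function.Injective (ev ρ) := by
  rw [injective_iff_map_eq_zero]
  rintro ⟨φ, hφ⟩ h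
  have hS : φ Smat = 0 := congrArg Prod.fst h
  have hU : φ Umat = 0 := congrArg Prod.snd h
  apply Subtype.ext
  funext g
  have hg : g ∈ Subgroup.closure {Smat, Umat} := by rw [closure_SU]; trivial
  change φ g = 0
  induction hg using Subgroup.closure_induction with
  | mem x hx =>
    rcases hx with rfl | rfl
    · exact hS
    · exact hU
  | one => exact Z1_one hone hφ
  | mul x y _ _ hx hy => rw [hφ x y, hx, hy]; simp
  | inv x _ hx =>
    have := hφ x x⁻¹
    rw [mul_inv_cancel, Z1_one hone hφ, hx] at this
    simpa using this.symm

/-- The affine map `x ↦ f x + a`. -/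
def aff (f : V →ₗ[F] V) (a : V) : V →ᵃ[F] V := f.toAffineMap + AffineMap.const F V a

lemma aff_apply (f : V →ₗ[F] V) (a x : V) : aff f a x = f x + a := rfl

lemma aff_linear (f : V →ₗ[F] V) (a : V) : (aff f a).linear = f := by
  simp [aff]

lemma exists_cocycle (hmul : ∀ g h : SL(2,ℤ), ρ (g * h) = (ρ h).comp (ρ g))
    (hone : ρ 1 = LinearMap.id) (hneg : ρ negOne = LinearMap.id) (a b : V)
    (ha : NS ρ a = 0) (hb : NU ρ b = 0) : ∃ φ ∈ Z1 ρ, φ Smat = a ∧ φ Umat = b := by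
  have hs : (MulOpposite.op (aff (ρ Smat) a)) ^ 2 = 1 := by
    rw [← MulOpposite.op_pow, ← MulOpposite.op_one]
    congr 1
    ext x
    rw [pow_two]
    change aff _ a (aff _ a x) = x
    simp only [NS, LinearMap.add_apply, LinearMap.id_apply] at ha
    simp only [aff_apply, map_add, rhoS hmul hneg, add_assoc, ha, add_zero]
  have hu : (MulOpposite.op (aff (ρ Umat) b)) ^ 3 = 1 := by
    rw [← MulOpposite.op_pow, ← MulOpposite.op_one]
    congr 1
    ext x
    rw [pow_succ, pow_two]
    change aff _ b (aff _ b (aff _ b x)) = x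
    simp only [NU, LinearMap.add_apply, LinearMap.id_apply, LinearMap.comp_apply, add_assoc] at hb
    simp only [aff_apply, map_add, rhoU hmul hneg, add_assoc, hb, add_zero]
  obtain ⟨Φ, h1, h2⟩ := exists_hom_monoid hs hu
  let R : SL(2,ℤ) →* (V →ₗ[F] V)ᵐᵒᵖ :=
    { toFun := fun g => MulOpposite.op (ρ g)
      map_one' := by rw [hone]; rfl
      map_mul' := fun g h => by rw [hmul]; rfl }
  have hR : (MonoidHom.op AffineMap.linearHom).comp Φ = R := by
    apply MonoidHom.eq_of_eqOn_dense closure_SU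
    rintro x (rfl | rfl)
    · change MulOpposite.op (Φ Smat).unop.linear = MulOpposite.op (ρ Smat)
      rw [h1, MulOpposite.unop_op, aff_linear]
    · change MulOpposite.op (Φ Umat).unop.linear = MulOpposite.op (ρ Umat)
      rw [h2, MulOpposite.unop_op, aff_linear]
  have hlin : ∀ g, (Φ g).unop.linear = ρ g := fun g =>
    congrArg MulOpposite.unop (DFunLike.congr_fun hR g)
  refine ⟨fun g => (Φ g).unop 0, ?_, ?_, ?_⟩
  · intro g h
    simp only [map_mul, MulOpposite.unop_mul, AffineMap.coe_mul, Function.comp_apply]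
    rw [← hlin h]
    have := (Φ h).unop.map_vadd 0 ((Φ g).unop 0)
    simpa using this
  · simp [h1, aff_apply]
  · simp [h2, aff_apply]

lemma range_ev (h2 : (2 : F) ≠ 0) (hmul : ∀ g h : SL(2,ℤ), ρ (g * h) = (ρ h).comp (ρ g))
    (hone : ρ 1 = LinearMap.id) (hneg : ρ negOne = LinearMap.id) :
    LinearMap.range (ev ρ) = (LinearMap.ker (NS ρ)).prod (LinearMap.ker (NU ρ)) := by
  apply le_antisymm
  · rintro _ ⟨⟨φ, hφ⟩, rfl⟩
    constructor
    · change NS ρ (φ Smat) = 0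
      rw [← Z1_neg h2 hone hneg hφ, ← S_sq, hφ]; rfl
    · change NU ρ (φ Umat) = 0
      rw [← Z1_neg h2 hone hneg hφ, ← U_cube, hφ, hφ, map_add]; rfl
  · rintro ⟨a, b⟩ ⟨ha, hb⟩
    obtain ⟨φ, hφ, e1, e2⟩ := exists_cocycle hmul hone hneg a b ha hb
    exact ⟨⟨φ, hφ⟩, Prod.ext e1 e2⟩

/-- The coboundary map. -/
def cob (hmul : ∀ g h : SL(2,ℤ), ρ (g * h) = (ρ h).comp (ρ g)) : V →ₗ[F] ↥(Z1 ρ) where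
  toFun v := ⟨fun g => ρ g v - v, fun g h => by simp [hmul]⟩
  map_add' v w := by apply Subtype.ext; funext g; simp; abel
  map_smul' c v := by apply Subtype.ext; funext g; simp [smul_sub]

lemma ker_cob (hmul : ∀ g h : SL(2,ℤ), ρ (g * h) = (ρ h).comp (ρ g)) :
    LinearMap.ker (cob hmul) = invariants ρ Set.univ := by
  ext v
  constructor
  · intro h g _
    exact sub_eq_zero.mp (congrFun (congrArg Subtype.val h) g)
  · intro h
    apply Subtype.ext; funext g
    exact sub_eq_zero.mpr (h g trivial)

lemma range_cob (hmul : ∀ g h : SL(2,ℤ), ρ (g * h) = (ρ h).comp (ρ g)) :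
    LinearMap.range (cob hmul) = (B1 ρ ⊓ Z1 ρ).comap (Z1 ρ).subtype := by
  ext φ
  constructor
  · rintro ⟨v, rfl⟩
    exact ⟨⟨v, fun g => rfl⟩, (cob hmul v).2⟩
  · rintro ⟨⟨v, hv⟩, _⟩
    exact ⟨v, Subtype.ext (funext fun g => (hv g).symm)⟩

/-- A product of submodules is the product of the modules. -/
def prodEq (p q : Submodule F V) : ↥(p.prod q) ≃ₗ[F] ↥p × ↥q where
  toFun x := (⟨x.1.1, x.2.1⟩, ⟨x.1.2, x.2.2⟩)
  invFun x := ⟨(x.1.1, x.2.1), x.1.2, x.2.2⟩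
  map_add' _ _ := rfl
  map_smul' _ _ := rfl
  left_inv _ := rfl
  right_inv _ := rfl

end main

end DimH1

/-- **Dimension of `H¹(SL₂(ℤ), V)` via Mayer–Vietoris.**
Let `V` be a finite-dimensional (right) representation of `Γ₁ = SL₂(ℤ)` over a field `F`
of characteristic different from `2` and `3`, on which `-1` acts trivially.  Then
`dim H¹(Γ₁, V) = dim V - dim H⁰(G₂, V) - dim H⁰(G₃, V) + dim H⁰(Γ₁, V)`,
where `G₂` and `G₃` are the subgroups of `PSL₂(ℤ)` generated by the images of
`S = [[0,-1],[1,0]]` and `U = [[1,-1],[1,0]]` (cyclic of orders 2 and 3); since `-1` acts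
trivially, `H⁰(G₂, V)` and `H⁰(G₃, V)` are the invariants of the subgroups of `SL₂(ℤ)`
generated by `S` and by `U`, and `H⁰(Γ₁, V)` is the `SL₂(ℤ)`-invariants. -/
theorem dim_H1_SL2Z {F : Type*} [Field F] (h2 : ringChar F ≠ 2) (h3 : ringChar F ≠ 3)
    {V : Type*} [AddCommGroup V] [Module F V] [FiniteDimensional F V]
    (ρ : SL(2,ℤ) → V →ₗ[F] V)
    (hmul : ∀ g h : SL(2,ℤ), ρ (g * h) = (ρ h).comp (ρ g))
    (hone : ρ 1 = LinearMap.id)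
    (hneg : ρ negOne = LinearMap.id) :
    (Module.finrank F (H1 ρ) : ℤ) =
      (Module.finrank F V : ℤ) -
        Module.finrank F (invariants ρ (Subgroup.closure {Smat} : Subgroup SL(2,ℤ))) -
        Module.finrank F (invariants ρ (Subgroup.closure {Umat} : Subgroup SL(2,ℤ))) +
        Module.finrank F (invariants ρ Set.univ) := by
  have two : (2 : F) ≠ 0 := Ring.two_ne_zero h2
  have three : (3 : F) ≠ 0 := by
    intro h
    have hd : ringChar F ∣ 3 := (ringChar.spec F 3).mp (by exact_mod_cast h)
    rcases (Nat.dvd_prime Nat.prime_three).mp hd with h1 | h1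
    · have := (ringChar.spec F 1).mpr (by rw [h1])
      simp at this
    · exact h3 h1
  have : FiniteDimensional F ↥(Z1 ρ) :=
    FiniteDimensional.of_injective (DimH1.ev ρ) (DimH1.ev_injective hone)
  have e1 := LinearMap.finrank_range_add_finrank_ker (DimH1.NS ρ)
  have e2 := LinearMap.finrank_range_add_finrank_ker (DimH1.NU ρ)
  have e3 := LinearMap.finrank_range_add_finrank_ker (DimH1.cob hmul)
  have e4 := LinearMap.finrank_range_of_inj (DimH1.ev_injective hone)
  have e5 := Submodule.finrank_quotient_add_finrank ((B1 ρ ⊓ Z1 ρ).comap (Z1 ρ).subtype)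
  have e6 : Module.finrank F (H1 ρ) =
    Module.finrank F (↥(Z1 ρ) ⧸ ((B1 ρ ⊓ Z1 ρ).comap (Z1 ρ).subtype)) := rfl
  rw [DimH1.range_NS two hmul hone hneg] at e1
  rw [DimH1.range_NU three hmul hone hneg] at e2
  rw [DimH1.ker_cob, DimH1.range_cob] at e3
  rw [DimH1.range_ev two hmul hone hneg,
    LinearEquiv.finrank_eq (DimH1.prodEq _ _), Module.finrank_prod] at e4
  omega
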